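/- The number of 12-point orthogonal arrays of strength 2 with 5 two-level factors and no replications is 192: the number of subsets F of D = {−1,+1}^5 with |F| = 12 such that Σ_{t ∈ F} X^γ(t) = 0 (in ℤ) for every exponent vector γ ∈ Fin 5 → ZMod 2 with 1 ≤ |γ| ≤ 2 (where |γ| is the number of nonzero coordinates of γ) equals 192. -/

import Mathlib

/-- The monomial `X^γ` on the full factorial design `D = {-1,+1}^m`:
`X^γ(t) = ∏_{i : γ i = 1} t i`. -/
def Xmon {m : ℕ} (γ : Fin m → ZMod 2) (t : Fin m → ℤˣ) : ℤˣ :=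
  ∏ i ∈ Finset.univ.filter (fun i => γ i = 1), t i

namespace OATwelve

/-- Profile of a subset of `{-1,+1}^3`: size, coordinate sums, pair sums. -/
structure P where
  n : ℤ
  x : ℤ
  y : ℤ
  z : ℤ
  p : ℤ
  q : ℤ
  r : ℤ

def P.add (a b : P) : P :=
  ⟨a.n + b.n, a.x + b.x, a.y + b.y, a.z + b.z, a.p + b.p, a.q + b.q, a.r + b.r⟩

/-- Profile of a whole fraction. -/
@[ext] structure M where
  n : ℤ
  a : ℤ
  b : ℤ
  x : ℤ
  y : ℤ
  z : ℤ
  ab : ℤ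
  ax : ℤ
  ay : ℤ
  az : ℤ
  bx : ℤ
  bY : ℤ
  bz : ℤ
  p : ℤ
  q : ℤ
  r : ℤ

def M.add (u v : M) : M :=
  ⟨u.n + v.n, u.a + v.a, u.b + v.b, u.x + v.x, u.y + v.y, u.z + v.z, u.ab + v.ab,
   u.ax + v.ax, u.ay + v.ay, u.az + v.az, u.bx + v.bx, u.bY + v.bY, u.bz + v.bz,
   u.p + v.p, u.q + v.q, u.r + v.r⟩

def M.zero : M := ⟨0,0,0,0,0,0,0,0,0,0,0,0,0,0,0,0⟩

/-- Embedding of a quarter with first two coordinates `a`, `b`. -/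
def emb (a b : ℤ) (u : P) : M :=
  ⟨u.n, a * u.n, b * u.n, u.x, u.y, u.z, a * b * u.n, a * u.x, a * u.y, a * u.z,
   b * u.x, b * u.y, b * u.z, u.p, u.q, u.r⟩

/-- All subset sums of a list. -/
def sums {α : Type} (add : α → α → α) (zero : α) : List α → List α
  | [] => [zero]
  | v :: l => sums add zero l ++ (sums add zero l).map (add v)

theorem sums_map {α β : Type} (add : α → α → α) (zero : α) (add' : β → β → β) (zero' : β)
    (e : α → β) (h0 : e zero = zero') (ha : ∀ u v, e (add u v) = add' (e u) (e v)) (l : List α) :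
    sums add' zero' (l.map e) = (sums add zero l).map e := by
  induction l with
  | nil => simp [sums, h0]
  | cons v l ih => simp [sums, ih, Function.comp_def, ha]

theorem M.add_assoc (u v w : M) : (u.add v).add w = u.add (v.add w) := by
  simp [M.add, _root_.add_assoc]

theorem M.zero_add (u : M) : M.zero.add u = u := by
  simp [M.add, M.zero]

theorem sums_append (l₁ l₂ : List M) (g : M → ℕ) :
    ((sums M.add M.zero (l₁ ++ l₂)).map g).sum =
      ((sums M.add M.zero l₁).map fun a =>
        ((sums M.add M.zero l₂).map fun b => g (a.add b)).sum).sum := by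
  induction l₁ generalizing g with
  | nil => simp [sums, M.zero_add]
  | cons v l ih =>
    simp only [List.cons_append, sums, List.map_append, List.sum_append, List.map_map,
      Function.comp_def, ih, M.add_assoc]

abbrev D := Fin 5 → ℤˣ

/-- Total profile of a fraction. -/
def tot (F : Finset D) : M :=
  ⟨F.card, ∑ t ∈ F, (t 0 : ℤ), ∑ t ∈ F, (t 1 : ℤ), ∑ t ∈ F, (t 2 : ℤ), ∑ t ∈ F, (t 3 : ℤ),
   ∑ t ∈ F, (t 4 : ℤ), ∑ t ∈ F, (t 0 * t 1 : ℤ), ∑ t ∈ F, (t 0 * t 2 : ℤ),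
   ∑ t ∈ F, (t 0 * t 3 : ℤ), ∑ t ∈ F, (t 0 * t 4 : ℤ), ∑ t ∈ F, (t 1 * t 2 : ℤ),
   ∑ t ∈ F, (t 1 * t 3 : ℤ), ∑ t ∈ F, (t 1 * t 4 : ℤ), ∑ t ∈ F, (t 2 * t 3 : ℤ),
   ∑ t ∈ F, (t 2 * t 4 : ℤ), ∑ t ∈ F, (t 3 * t 4 : ℤ)⟩

def prof (t : D) : M :=
  ⟨1, t 0, t 1, t 2, t 3, t 4, t 0 * t 1, t 0 * t 2, t 0 * t 3, t 0 * t 4, t 1 * t 2,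
   t 1 * t 3, t 1 * t 4, t 2 * t 3, t 2 * t 4, t 3 * t 4⟩

theorem tot_insert (t : D) (F : Finset D) (h : t ∉ F) :
    tot (insert t F) = (prof t).add (tot F) := by
  simp [tot, prof, M.add, Finset.sum_insert h, Finset.card_insert_of_notMem h, add_comm]

theorem sum_powerset (l : List D) (hl : l.Nodup) (g : M → ℕ) :
    ∑ F ∈ l.toFinset.powerset, g (tot F) =
      ((sums M.add M.zero (l.map prof)).map g).sum := by
  induction l generalizing g with
  | nil => simp [sums, tot, M.zero]
  | cons t l ih =>
    rw [List.nodup_cons] at hl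
    have ht : t ∉ l.toFinset := by simpa using hl.1
    rw [List.toFinset_cons, Finset.sum_powerset_insert ht]
    have : ∀ F ∈ l.toFinset.powerset, g (tot (insert t F)) = g ((prof t).add (tot F)) := by
      intro F hF
      rw [tot_insert]
      exact fun h => ht (Finset.mem_powerset.1 hF h)
    rw [Finset.sum_congr rfl this, ih hl.2, ih hl.2 (fun m => g ((prof t).add m))]
    simp [sums, Function.comp_def]

def pts (a b : ℤˣ) : List D :=
  [![a,b,1,1,1], ![a,b,1,1,-1], ![a,b,1,-1,1], ![a,b,1,-1,-1],
   ![a,b,-1,1,1], ![a,b,-1,1,-1], ![a,b,-1,-1,1], ![a,b,-1,-1,-1]]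

def allPts : List D := pts 1 1 ++ (pts 1 (-1) ++ (pts (-1) 1 ++ pts (-1) (-1)))

def cube : List P :=
  [⟨1,1,1,1,1,1,1⟩, ⟨1,1,1,-1,1,-1,-1⟩, ⟨1,1,-1,1,-1,1,-1⟩, ⟨1,1,-1,-1,-1,-1,1⟩,
   ⟨1,-1,1,1,-1,-1,1⟩, ⟨1,-1,1,-1,-1,1,-1⟩, ⟨1,-1,-1,1,1,-1,-1⟩, ⟨1,-1,-1,-1,1,1,1⟩]

def S : List P := sums P.add ⟨0,0,0,0,0,0,0⟩ cube

theorem pts_prof (a b : ℤˣ) : (pts a b).map prof = cube.map (emb a b) := by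
  simp [pts, prof, cube, emb]

theorem sums_pts (a b : ℤˣ) :
    sums M.add M.zero ((pts a b).map prof) = S.map (emb a b) := by
  rw [pts_prof, S]
  apply sums_map
  · simp [emb, M.zero]
  · intro u v
    simp [emb, P.add, M.add, mul_add]

theorem allPts_nodup : allPts.Nodup := by decide +kernel

theorem allPts_univ : allPts.toFinset = Finset.univ := by
  apply Finset.eq_univ_of_card
  rw [List.toFinset_card_of_nodup allPts_nodup]
  simp [allPts, pts]

def T : M := ⟨12,0,0,0,0,0,0,0,0,0,0,0,0,0,0,0⟩

theorem cond_iff (F : Finset D) :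
    (F.card = 12 ∧
      ∀ γ : Fin 5 → ZMod 2,
        1 ≤ (Finset.univ.filter fun i => γ i ≠ 0).card →
        (Finset.univ.filter fun i => γ i ≠ 0).card ≤ 2 →
        ∑ t ∈ F, (Xmon γ t : ℤ) = 0) ↔ tot F = T := by
  have key : ∀ (γ : Fin 5 → ZMod 2) (t : D), (Xmon γ t : ℤ) =
      ∏ i, if γ i = 1 then (t i : ℤ) else 1 := by
    intro γ t
    simp [Xmon, Finset.prod_filter]
    apply Finset.prod_congr rfl
    intro i _
    split_ifs <;> simp
  constructor
  · rintro ⟨hc, h⟩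
    have h' : ∀ γ : Fin 5 → ZMod 2,
        (1 ≤ (Finset.univ.filter fun i => γ i ≠ 0).card ∧
        (Finset.univ.filter fun i => γ i ≠ 0).card ≤ 2) →
        ∑ t ∈ F, ∏ i, (if γ i = 1 then (t i : ℤ) else 1) = 0 := by
      intro γ hγ
      simpa only [key] using h γ hγ.1 hγ.2
    have h0 := h' ![1,0,0,0,0] (by decide)
    have h1 := h' ![0,1,0,0,0] (by decide)
    have h2 := h' ![0,0,1,0,0] (by decide)
    have h3 := h' ![0,0,0,1,0] (by decide)
    have h4 := h' ![0,0,0,0,1] (by decide)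
    have h01 := h' ![1,1,0,0,0] (by decide)
    have h02 := h' ![1,0,1,0,0] (by decide)
    have h03 := h' ![1,0,0,1,0] (by decide)
    have h04 := h' ![1,0,0,0,1] (by decide)
    have h12 := h' ![0,1,1,0,0] (by decide)
    have h13 := h' ![0,1,0,1,0] (by decide)
    have h14 := h' ![0,1,0,0,1] (by decide)
    have h23 := h' ![0,0,1,1,0] (by decide)
    have h24 := h' ![0,0,1,0,1] (by decide)
    have h34 := h' ![0,0,0,1,1] (by decide)
    simp [Fin.prod_univ_five] at h0 h1 h2 h3 h4 h01 h02 h03 h04 h12 h13 h14 h23 h24 h34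
    simp [tot, T, *]
  · intro h
    simp only [tot, T, M.mk.injEq] at h
    obtain ⟨hc, h⟩ := h
    refine ⟨by exact_mod_cast hc, ?_⟩
    intro γ h1 h2
    simp only [key, Fin.prod_univ_five]
    have hz : ∀ z : ZMod 2, z = 0 ∨ z = 1 := by decide
    simp only [Finset.card_filter, Fin.sum_univ_five] at h1 h2
    rcases hz (γ 0) with e0 | e0 <;> rcases hz (γ 1) with e1 | e1 <;>
    rcases hz (γ 2) with e2 | e2 <;> rcases hz (γ 3) with e3 | e3 <;>
    rcases hz (γ 4) with e4 | e4 <;> simp [e0, e1, e2, e3, e4] at h1 h2 ⊢ <;> simp [h]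

theorem sum_ite {α : Type} (l : List α) (c : α → Bool) (f : α → ℕ) :
    (l.map fun x => if c x = true then f x else 0).sum = ((l.filter c).map f).sum := by
  induction l with
  | nil => simp
  | cons v l ih => by_cases h : c v = true <;> simp [h, ih]

/-- Same size 3, opposite coordinate sums. -/
def opp (a b : P) : Bool := decide (a.x + b.x = 0) && decide (a.y + b.y = 0) && decide (a.z + b.z = 0)
def three (a : P) : Bool := decide (a.n = 3)
def bal (a b c d : P) : Bool :=
  decide (a.p + b.p + (c.p + d.p) = 0) && decide (a.q + b.q + (c.q + d.q) = 0)
    && decide (a.r + b.r + (c.r + d.r) = 0)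

theorem split_cond (a b c d : P) :
    ((emb 1 1 a).add ((emb 1 (-1) b).add ((emb (-1) 1 c).add (emb (-1) (-1) d))) = T) ↔
    (three a = true ∧ (three b = true ∧ opp a b = true) ∧ (three c = true ∧ opp a c = true) ∧
      (three d = true ∧ opp b d = true) ∧ bal a b c d = true) := by
  simp only [emb, M.add, T, three, opp, bal, M.mk.injEq, Bool.and_eq_true, decide_eq_true_eq]
  constructor
  · intro h
    refine ⟨?_, ⟨?_, ⟨?_, ?_⟩, ?_⟩, ⟨?_, ⟨?_, ?_⟩, ?_⟩, ⟨?_, ⟨?_, ?_⟩, ?_⟩, ⟨?_, ?_⟩, ?_⟩ <;> omega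
  · intro h
    refine ⟨?_, ?_, ?_, ?_, ?_, ?_, ?_, ?_, ?_, ?_, ?_, ?_, ?_, ?_, ?_, ?_⟩ <;> omega

def S3 : List P := S.filter three

def total : ℕ :=
  (S3.map fun a =>
    (fun B : List P =>
      (B.map fun b => (B.map fun c =>
        (((S3.filter (opp b)).filter (bal a b c)).map fun _ => 1).sum).sum).sum)
    (S3.filter (opp a))).sum

theorem total_eq : total = 192 := by decide +kernel

open Classical in
theorem count_eq :
    (S.map fun a => (S.map fun b => (S.map fun c => (S.map fun d =>
      if (emb 1 1 a).add ((emb 1 (-1) b).add ((emb (-1) 1 c).add (emb (-1) (-1) d))) = T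
        then 1 else 0).sum).sum).sum).sum = total := by
  classical
  simp only [split_cond, total, S3, ← sum_ite]
  have push : ∀ (c : Prop) [Decidable c] (f : P → ℕ) (l : List P),
      (if c then (l.map f).sum else 0) = (l.map fun x => if c then f x else 0).sum := by
    intro c _ f l
    split_ifs <;> simp
  simp only [push]
  refine congrArg List.sum (List.map_congr_left fun a _ => ?_)
  refine congrArg List.sum (List.map_congr_left fun b _ => ?_)
  refine congrArg List.sum (List.map_congr_left fun c _ => ?_)
  refine congrArg List.sum (List.map_congr_left fun d _ => ?_)
  simp only [← ite_and]
  refine if_congr ?_ rfl rfl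
  tauto

end OATwelve

open OATwelve in
/-- There are exactly 192 orthogonal arrays of strength 2 with 12 points, 5
two-level factors and no replications: 12-element subsets `F` of
`D = {-1,+1}^5` with `∑_{t ∈ F} X^γ(t) = 0` for all `γ` with `1 ≤ |γ| ≤ 2`. -/
theorem card_strength_two_OA_twelve :
    Nat.card {F : Finset (Fin 5 → ℤˣ) //
      F.card = 12 ∧
      ∀ γ : Fin 5 → ZMod 2,
        1 ≤ (Finset.univ.filter fun i => γ i ≠ 0).card →
        (Finset.univ.filter fun i => γ i ≠ 0).card ≤ 2 →
        ∑ t ∈ F, (Xmon γ t : ℤ) = 0} = 192 := by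
  classical
  simp only [cond_iff]
  rw [Nat.card_eq_fintype_card, Fintype.card_subtype, Finset.card_filter, ← Finset.powerset_univ,
    ← allPts_univ]
  rw [sum_powerset allPts allPts_nodup (fun m => if m = T then 1 else 0)]
  simp only [allPts, List.map_append, sums_append, sums_pts, List.map_map, Function.comp_def]
  rw [← total_eq, ← count_eq]
  simp
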